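/- Let 1 → H → G → K → 1 be a short exact sequence of groups where H is a Poincaré duality group of cohomological dimension h. Then for every p ≥ 0, H^p(K; ℤK) = 0 if and only if H^{p+h}(G; ℤG) = 0. In particular, if K is of type FP and G is a duality group of cohomological dimension h + k, then K is a duality group of cohomological dimension k. -/

import Mathlib

open CategoryTheory

/-- A group `G` is of type `FP` if the trivial `ℤG`-module `ℤ` admits a finite-length
resolution by finitely generated projective `ℤG`-modules. -/
def TypeFP (G : Type) [Group G] : Prop :=
  ∃ (res : ProjectiveResolution (Rep.trivial ℤ G ℤ)) (n : ℕ),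
    (∀ i : ℕ, Module.Finite (MonoidAlgebra ℤ G)
      (Rep.equivalenceModuleMonoidAlgebra.functor.obj (res.complex.X i))) ∧
    (∀ i : ℕ, n < i → Subsingleton (res.complex.X i))

/-- `H^n(G; ℤG)` : group cohomology with coefficients in the left regular representation. -/
noncomputable abbrev cohZG (G : Type) [Group G] (n : ℕ) :=
  groupCohomology (Rep.leftRegular ℤ G) n

/-- `G` is a duality group of cohomological dimension `n`. -/
def IsDualityGroup (G : Type) [Group G] (n : ℕ) : Prop :=
  TypeFP G ∧ (∀ i : ℕ, i ≠ n → Subsingleton (cohZG G i)) ∧ Nontrivial (cohZG G n)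

/-- `G` is a Poincaré duality group of cohomological dimension `n`. -/
def IsPDGroup (G : Type) [Group G] (n : ℕ) : Prop :=
  TypeFP G ∧ (∀ i : ℕ, i ≠ n → Subsingleton (cohZG G i)) ∧
    Nonempty ((cohZG G n) ≃+ ℤ)

section
open Limits

section ExactSequences
variable {C : Type*} [Category C] [Abelian C] (K : CochainComplex C ℕ) (n : ℕ)

lemma prev_eq_sub_one : (ComplexShape.up ℕ).prev n = n - 1 := by
  cases n <;> simp

lemma exact_iCycles_d :
    (ShortComplex.mk (K.iCycles n) (K.d n (n + 1)) (by simp)).Exact :=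
  ShortComplex.exact_of_f_is_kernel _ (K.cyclesIsKernel n (n + 1) (by simp))

lemma exact_toCycles_homologyπ :
    (ShortComplex.mk (K.toCycles (n - 1) n) (K.homologyπ n) (by simp)).Exact :=
  ShortComplex.exact_of_g_is_cokernel _ (K.homologyIsCokernel (n - 1) n (prev_eq_sub_one n))

lemma exact_iCycles_toCycles :
    (ShortComplex.mk (K.iCycles n) (K.toCycles n (n + 1))
      (by simp [← cancel_mono (K.iCycles _)])).Exact := by
  refine (ShortComplex.exact_iff_of_epi_of_isIso_of_mono
    (S₁ := ShortComplex.mk (K.iCycles n) (K.toCycles n (n + 1))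
      (by simp [← cancel_mono (K.iCycles _)]))
    (S₂ := ShortComplex.mk (K.iCycles n) (K.d n (n + 1)) (by simp))
    { τ₁ := 𝟙 _, τ₂ := 𝟙 _, τ₃ := K.iCycles _ }).2 (exact_iCycles_d K n)

end ExactSequences

section Cocycles
variable {k G : Type} [CommRing k] [Group G]

lemma rep_exact_iff (S : ShortComplex (Rep.{0} k G)) :
    S.Exact ↔ ∀ x : S.X₂, S.g.hom x = 0 → ∃ y : S.X₁, S.f.hom y = x := by
  have h := ShortComplex.exact_map_iff_of_faithful S (forget₂ (Rep.{0} k G) (ModuleCat.{0} k))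
  rw [← h, ShortComplex.moduleCat_exact_iff]
  rfl

variable (P : ProjectiveResolution (Rep.trivial k G k)) (A : Rep.{0} k G) (n : ℕ)

theorem subsingleton_groupCohomology_iff : Subsingleton (groupCohomology A n) ↔
    ∀ f : P.complex.X n ⟶ A, P.complex.d (n + 1) n ≫ f = 0 →
      ∃ g : P.complex.X (n - 1) ⟶ A, P.complex.d n (n - 1) ≫ g = f := by
  rw [← ModuleCat.isZero_iff_subsingleton, (groupCohomologyIso A n P).isZero_iff,
    ← HomologicalComplex.exactAt_iff_isZero_homology,
    HomologicalComplex.exactAt_iff' _ (n - 1) n (n + 1) (prev_eq_sub_one n) (by simp),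
    ShortComplex.moduleCat_exact_iff]
  rfl

theorem exists_generator_of_homology_equiv (K : CochainComplex (ModuleCat.{0} k) ℕ) (n : ℕ)
    (e : K.homology n ≃ₗ[k] k) :
    ∃ x₁ : K.X n, K.d n (n + 1) x₁ = 0 ∧
      (∀ x : K.X n, K.d n (n + 1) x = 0 →
        ∃ (m : k) (y : K.X (n - 1)), x = m • x₁ + K.d (n - 1) n y) ∧
      ∀ (m : k) (y : K.X (n - 1)), m • x₁ = K.d (n - 1) n y → m = 0 := by
  have hi : Function.Injective (K.iCycles n) :=
    (ModuleCat.mono_iff_injective _).1 inferInstance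
  have hex : ∀ x : K.X n, K.d n (n + 1) x = 0 → ∃ z : K.cycles n, K.iCycles n z = x :=
    (ShortComplex.moduleCat_exact_iff _).1 (exact_iCycles_d K n)
  have hex' : ∀ z : K.cycles n, K.homologyπ n z = 0 →
      ∃ y : K.X (n - 1), K.toCycles (n - 1) n y = z :=
    (ShortComplex.moduleCat_exact_iff _).1 (exact_toCycles_homologyπ K n)
  have hti (g : K.X (n - 1)) : K.iCycles n (K.toCycles (n - 1) n g) = K.d (n - 1) n g := by
    rw [← ConcreteCategory.comp_apply, K.toCycles_i]
  have hπt (g : K.X (n - 1)) : K.homologyπ n (K.toCycles (n - 1) n g) = 0 := by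
    rw [← ConcreteCategory.comp_apply, K.toCycles_comp_homologyπ]; rfl
  obtain ⟨z₁, hz₁⟩ := (ModuleCat.epi_iff_surjective (K.homologyπ n)).1 inferInstance (e.symm 1)
  refine ⟨K.iCycles n z₁, ?_, fun f hf => ?_, fun m g hg => ?_⟩
  · rw [← ConcreteCategory.comp_apply, K.iCycles_d]; rfl
  · obtain ⟨z, rfl⟩ := hex f hf
    obtain ⟨g, hg⟩ := hex' (z - e (K.homologyπ n z) • z₁) (by
      apply e.injective
      rw [map_sub, map_smul, hz₁, map_sub, map_smul, e.apply_symm_apply, smul_eq_mul, mul_one,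
        sub_self, map_zero])
    refine ⟨e (K.homologyπ n z), g, ?_⟩
    rw [← hti, hg, map_sub, map_smul]
    exact (add_sub_cancel _ _).symm
  · have h1 : m • z₁ = K.toCycles (n - 1) n g := hi (by rw [map_smul, hti]; exact hg)
    have h2 := congr(e (K.homologyπ n $h1))
    rw [hπt, map_smul, hz₁, map_smul, e.apply_symm_apply, smul_eq_mul, mul_one, map_zero] at h2
    exact h2

theorem exists_generator_of_groupCohomology_equiv (e : groupCohomology A n ≃ₗ[k] k) :
    ∃ f₁ : P.complex.X n ⟶ A, P.complex.d (n + 1) n ≫ f₁ = 0 ∧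
      (∀ f : P.complex.X n ⟶ A, P.complex.d (n + 1) n ≫ f = 0 →
        ∃ (m : k) (g : P.complex.X (n - 1) ⟶ A), f = m • f₁ + P.complex.d n (n - 1) ≫ g) ∧
      ∀ (m : k) (g : P.complex.X (n - 1) ⟶ A), m • f₁ = P.complex.d n (n - 1) ≫ g → m = 0 :=
  exists_generator_of_homology_equiv _ n
    ((groupCohomologyIso A n P).toLinearEquiv.symm.trans e)

end Cocycles

/-- An additive equivalence between integral modules is linear. -/
def AddEquiv.intLinear {M : Type*} [AddCommGroup M] [Module ℤ M] (e : M ≃+ ℤ) : M ≃ₗ[ℤ] ℤ :=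
  { e with
    map_smul' := fun m x => by
      simpa using map_intCast_smul e ℤ ℤ m x }

section Acyclic
variable {k G : Type} [CommRing k] [Group G]

/-- The linear map out of a free module determined by its values on the basis. -/
noncomputable def basisLift {X V : Type*} [AddCommGroup V] [Module k V] (φ : X → V) :
    MonoidAlgebra k X →ₗ[k] V :=
  Finsupp.lift V k X φ ∘ₗ (MonoidAlgebra.coeffLinearEquiv k).toLinearMap

@[simp]
lemma basisLift_single {X V : Type*} [AddCommGroup V] [Module k V] (φ : X → V) (x : X) (r : k) :
    basisLift φ (MonoidAlgebra.single x r) = r • φ x := by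
  simp [basisLift]

lemma eq_of_basis {X V F : Type*} [AddCommGroup V] [Module k V]
    [FunLike F (MonoidAlgebra k X) V] [LinearMapClass F k (MonoidAlgebra k X) V] {f g : F}
    (h : ∀ x, f (MonoidAlgebra.single x 1) = g (MonoidAlgebra.single x 1)) (v) : f v = g v := by
  have : (f : MonoidAlgebra k X →ₗ[k] V) = g :=
    MonoidAlgebra.lhom_ext' fun x => LinearMap.ext_ring (h x)
  exact congr($this v)

/-- The morphism of representations out of a permutation module determined by an equivariant
map. -/
noncomputable def ofMulActionLift {X : Type} [MulAction G X] (A : Rep.{0} k G) (φ : X → A)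
    (hφ : ∀ g x, φ (g • x) = A.ρ g (φ x)) : Rep.ofMulAction k G X ⟶ A :=
  Rep.ofHom ⟨basisLift φ, fun g => MonoidAlgebra.lhom_ext' fun x => LinearMap.ext_ring (by
    simp [hφ])⟩

lemma ofMulActionLift_single {X : Type} [MulAction G X] (A : Rep.{0} k G) (φ : X → A)
    (hφ : ∀ g x, φ (g • x) = A.ρ g (φ x)) (x : X) (r : k) :
    (ofMulActionLift A φ hφ).hom (MonoidAlgebra.single x r) = r • φ x :=
  basisLift_single φ x r

lemma ofMulAction_hom_ext {X : Type} [MulAction G X] {A : Rep.{0} k G}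
    {f g : Rep.ofMulAction k G X ⟶ A}
    (h : ∀ x, f.hom (MonoidAlgebra.single x 1) = g.hom (MonoidAlgebra.single x 1)) : f = g := by
  exact Rep.hom_ext (Representation.IntertwiningMap.ext (LinearMap.ext (eq_of_basis h)))

lemma standardComplex_d_single (n : ℕ) (x : Fin (n + 2) → G) :
    ((Rep.standardComplex k G).d (n + 1) n).hom (MonoidAlgebra.single x (1 : k)) =
      ∑ p : Fin (n + 2), MonoidAlgebra.single (x ∘ p.succAbove) ((-1 : k) ^ p.val) := by
  exact (Rep.standardComplex.d_apply k G _).trans (Rep.standardComplex.d_of x)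

theorem subsingleton_groupCohomology_succ_of_mean (J : Rep.{0} k G) (E : (G → J) →ₗ[k] J)
    (hconst : ∀ v, E (fun _ => v) = v)
    (hE : ∀ g φ, E (fun x => J.ρ g (φ (g⁻¹ * x))) = J.ρ g (E φ)) (n : ℕ) :
    Subsingleton (groupCohomology J (n + 1)) := by
  rw [subsingleton_groupCohomology_iff (Rep.standardResolution k G)]
  intro (f : Rep.ofMulAction k G (Fin (n + 2) → G) ⟶ J) hf
  have hfe (g : G) (x : Fin (n + 2) → G) :
      f.hom (MonoidAlgebra.single (g • x) 1) = J.ρ g (f.hom (MonoidAlgebra.single x 1)) := by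
    rw [← Rep.hom_comm_apply]
    simp
  have key (a : G) (x : Fin (n + 2) → G) : f.hom (MonoidAlgebra.single x 1) =
      ∑ p : Fin (n + 2), (-1 : k) ^ p.val •
        f.hom (MonoidAlgebra.single (Fin.cons a (x ∘ p.succAbove) : Fin (n + 2) → G) 1) := by
    have h1 : f.hom (((Rep.standardComplex k G).d (n + 2) (n + 1)).hom
        (MonoidAlgebra.single (Fin.cons a x : Fin (n + 3) → G) 1)) = 0 :=
      congr($(hf).hom (MonoidAlgebra.single (Fin.cons a x : Fin (n + 3) → G) 1))
    rw [standardComplex_d_single] at h1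
    have h2 : ∑ p : Fin (n + 3), (-1 : k) ^ p.val •
        f.hom (MonoidAlgebra.single ((Fin.cons a x : Fin (n + 3) → G) ∘ p.succAbove) 1) = 0 := by
      rw [← h1]
      refine Eq.trans ?_ (map_sum f.hom _ _).symm
      refine Finset.sum_congr rfl fun p _ => ?_
      rw [← map_smul, MonoidAlgebra.smul_single, smul_eq_mul, mul_one]
    rw [Fin.sum_univ_succ] at h2
    have h3 : (Fin.cons a x : Fin (n + 3) → G) ∘ (0 : Fin (n + 3)).succAbove = x := by
      ext i; simp
    have h4 (p : Fin (n + 2)) : (Fin.cons a x : Fin (n + 3) → G) ∘ p.succ.succAbove =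
        Fin.cons a (x ∘ p.succAbove) := by
      ext i
      refine Fin.cases ?_ (fun i => ?_) i <;> simp
    simp only [h3, h4, Fin.val_zero, pow_zero, one_smul, Fin.val_succ, pow_succ, mul_neg, mul_one,
      neg_smul, Finset.sum_neg_distrib] at h2
    exact add_neg_eq_zero.1 h2
  have hequiv (g : G) (x : Fin (n + 1) → G) :
      (E fun a => f.hom (MonoidAlgebra.single (Fin.cons a (g • x) : Fin (n + 2) → G) 1)) =
      J.ρ g (E fun a => f.hom (MonoidAlgebra.single (Fin.cons a x : Fin (n + 2) → G) 1)) := by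
    rw [← hE]
    congr 1
    ext a
    rw [← hfe]
    congr 2
    ext i
    refine Fin.cases ?_ (fun i => ?_) i <;> simp
  obtain ⟨s, hs⟩ : ∃ s : (Rep.standardComplex k G).X n ⟶ J,
      ∀ (x : Fin (n + 1) → G) (r : k), s.hom (MonoidAlgebra.single x r) =
        r • E fun a => f.hom (MonoidAlgebra.single (Fin.cons a x : Fin (n + 2) → G) 1) :=
    ⟨ofMulActionLift (X := Fin (n + 1) → G) J _ hequiv, ofMulActionLift_single J _ hequiv⟩
  have hsd (x : Fin (n + 2) → G) : s.hom (((Rep.standardComplex k G).d (n + 1) n).hom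
      (MonoidAlgebra.single x 1)) = f.hom (MonoidAlgebra.single x 1) := by
    rw [standardComplex_d_single]
    refine (map_sum s.hom _ _).trans ?_
    rw [← hconst (f.hom (MonoidAlgebra.single x 1))]
    have : (fun _ : G => f.hom (MonoidAlgebra.single x 1)) =
        ∑ p : Fin (n + 2), (-1 : k) ^ p.val • fun a =>
          f.hom (MonoidAlgebra.single (Fin.cons a (x ∘ p.succAbove) : Fin (n + 2) → G) 1) := by
      ext a
      rw [key a]
      simp
    rw [this, map_sum]
    refine Finset.sum_congr rfl fun p _ => ?_
    exact (hs _ _).trans (map_smul E _ _).symm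
  exact ⟨s, ofMulAction_hom_ext (X := Fin (n + 2) → G)
    (f := (Rep.standardComplex k G).d (n + 1) n ≫ s) hsd⟩

end Acyclic

section LES
variable {k G : Type} [CommRing k] [Group G]

/-- A representation is acyclic if its higher group cohomology vanishes. -/
def IsAcyclicRep (A : Rep.{0} k G) : Prop :=
  ∀ n : ℕ, IsZero (groupCohomology A (n + 1))

lemma IsAcyclicRep.of_isZero {A : Rep.{0} k G} (hA : IsZero A) : IsAcyclicRep A := fun n =>
  (groupCohomology.functor k G (n + 1)).map_isZero hA

lemma isZero_groupCohomology_zero_iff (A : Rep.{0} k G) :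
    IsZero (groupCohomology A 0) ↔ ∀ x : A, (∀ g, A.ρ g x = x) → x = 0 := by
  rw [(groupCohomology.H0Iso A).isZero_iff, ModuleCat.isZero_iff_subsingleton]
  constructor
  · intro h x hx
    exact congr(($(Subsingleton.elim (⟨x, hx⟩ : A.ρ.invariants) 0) : A))
  · intro h
    refine ⟨fun x y => Subtype.ext ?_⟩
    exact (h x.1 x.2).trans (h y.1 y.2).symm

variable {X : ShortComplex (Rep.{0} k G)}

lemma epi_map_zero_iff (X : ShortComplex (Rep.{0} k G)) :
    Epi (groupCohomology.map (MonoidHom.id G) X.g 0) ↔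
    ∀ z : X.X₃, (∀ g, X.X₃.ρ g z = z) → ∃ y : X.X₂, (∀ g, X.X₂.ρ g y = y) ∧ X.g.hom y = z := by
  have h1 : Epi (groupCohomology.map (MonoidHom.id G) X.g 0) ↔
      Epi ((Rep.invariantsFunctor k G).map X.g) := by
    rw [← epi_comp_iff_of_isIso _ (groupCohomology.H0Iso X.X₃).hom,
      groupCohomology.map_id_comp_H0Iso_hom, epi_comp_iff_of_epi]
  rw [h1, ModuleCat.epi_iff_surjective]
  constructor
  · intro h z hz
    obtain ⟨y, hy⟩ := h ⟨z, hz⟩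
    exact ⟨y.1, y.2, congr(($hy).1)⟩
  · rintro h ⟨z, hz⟩
    obtain ⟨y, hy, hyz⟩ := h z hz
    exact ⟨⟨y, hy⟩, Subtype.ext hyz⟩

namespace CategoryTheory.ShortComplex.ShortExact

lemma isAcyclicRep_X₃ (hX : X.ShortExact) (h₁ : IsAcyclicRep X.X₁) (h₂ : IsAcyclicRep X.X₂) :
    IsAcyclicRep X.X₃ :=
  fun n => (groupCohomology.mapShortComplex₃_exact hX (i := n + 1) rfl).isZero_of_both_zeros
    ((h₂ n).eq_of_src _ _) ((h₁ (n + 1)).eq_of_tgt _ _)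

lemma isZero_groupCohomology_X₃_iff (hX : X.ShortExact) (h₂ : IsAcyclicRep X.X₂) (n : ℕ) :
    IsZero (groupCohomology X.X₃ (n + 1)) ↔ IsZero (groupCohomology X.X₁ (n + 2)) := by
  have := groupCohomology.isIso_δ_of_isZero hX (n + 1) (h₂ n) (h₂ (n + 1))
  exact (asIso (groupCohomology.δ hX (n + 1) (n + 2) rfl)).isZero_iff

lemma isZero_groupCohomology_X₂_iff (hX : X.ShortExact) (h₁ : IsAcyclicRep X.X₁) (n : ℕ) :
    IsZero (groupCohomology X.X₂ (n + 1)) ↔ IsZero (groupCohomology X.X₃ (n + 1)) :=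
  ⟨fun h => (groupCohomology.mapShortComplex₃_exact hX (i := n + 1) rfl).isZero_of_both_zeros
      (h.eq_of_src _ _) ((h₁ (n + 1)).eq_of_tgt _ _),
    fun h => (groupCohomology.mapShortComplex₂_exact hX (n + 1)).isZero_of_both_zeros
      ((h₁ n).eq_of_src _ _) (h.eq_of_tgt _ _)⟩

lemma exists_invariant_lift (hX : X.ShortExact) (h₁ : IsZero (groupCohomology X.X₁ 1)) (z : X.X₃)
    (hz : ∀ g, X.X₃.ρ g z = z) : ∃ y : X.X₂, (∀ g, X.X₂.ρ g y = y) ∧ X.g.hom y = z :=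
  (epi_map_zero_iff X).1 ((groupCohomology.mapShortComplex₃_exact hX (i := 0) rfl).epi_f
    (h₁.eq_of_tgt _ _)) z hz

lemma isZero_groupCohomology_one_iff (hX : X.ShortExact) (h₂ : IsAcyclicRep X.X₂) :
    IsZero (groupCohomology X.X₁ 1) ↔
    ∀ z : X.X₃, (∀ g, X.X₃.ρ g z = z) → ∃ y : X.X₂, (∀ g, X.X₂.ρ g y = y) ∧ X.g.hom y = z := by
  refine ⟨exists_invariant_lift hX, fun h => ?_⟩
  have h' := (epi_map_zero_iff X).2 h
  exact (groupCohomology.mapShortComplex₁_exact hX (i := 0) rfl).isZero_of_both_zeros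
    (((groupCohomology.mapShortComplex₃_exact hX (i := 0) rfl).epi_f_iff).1 h')
    ((h₂ 0).eq_of_tgt _ _)

end CategoryTheory.ShortComplex.ShortExact

end LES

section Collapse
variable {k G : Type} [CommRing k] [Group G]

lemma shortExact_cycles {C : Type*} [Category C] [Abelian C] (K : CochainComplex C ℕ) (n : ℕ)
    (hK : K.ExactAt (n + 1)) :
    (ShortComplex.mk (K.iCycles n) (K.toCycles n (n + 1))
      (by simp [← cancel_mono (K.iCycles _)])).ShortExact where
  exact := exact_iCycles_toCycles K n
  mono_f := inferInstanceAs (Mono (K.iCycles n))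
  epi_g := by
    have h := (exact_toCycles_homologyπ K (n + 1)).epi_f
      ((HomologicalComplex.exactAt_iff_isZero_homology _ _).1 hK |>.eq_of_tgt _ _)
    exact h

lemma shortExact_kernel {C : Type*} [Category C] [Abelian C] {A B : C} (f : A ⟶ B) [Epi f] :
    (ShortComplex.mk (kernel.ι f) f (by simp)).ShortExact where
  exact := ShortComplex.exact_of_f_is_kernel _ (kernelIsKernel f)
  mono_f := inferInstanceAs (Mono (kernel.ι f))
  epi_g := inferInstanceAs (Epi f)

/-- The map from cochains to the boundaries of the next degree. -/
noncomputable def toBoundaries {C : Type*} [Category C] [Abelian C] (K : CochainComplex C ℕ)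
    (n : ℕ) : K.X (n - 1) ⟶ kernel (K.homologyπ n) :=
  kernel.lift _ (K.toCycles (n - 1) n) (by simp)

lemma toBoundaries_ι {C : Type*} [Category C] [Abelian C] (K : CochainComplex C ℕ) (n : ℕ) :
    toBoundaries K n ≫ kernel.ι _ = K.toCycles (n - 1) n := by
  simp [toBoundaries]

instance {C : Type*} [Category C] [Abelian C] (K : CochainComplex C ℕ) (n : ℕ) :
    Epi (toBoundaries K n) :=
  (exact_toCycles_homologyπ K n).epi_kernelLift

lemma shortExact_boundaries {C : Type*} [Category C] [Abelian C] (K : CochainComplex C ℕ)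
    (n : ℕ) :
    (ShortComplex.mk (K.iCycles n) (toBoundaries K (n + 1)) (by
      rw [← cancel_mono (kernel.ι _), Category.assoc, toBoundaries_ι]
      simp [← cancel_mono (K.iCycles _)])).ShortExact where
  exact := by
    refine (ShortComplex.exact_iff_of_epi_of_isIso_of_mono
      (S₁ := ShortComplex.mk (K.iCycles n) (toBoundaries K (n + 1)) _)
      (S₂ := ShortComplex.mk (K.iCycles n) (K.toCycles n (n + 1))
        (by simp [← cancel_mono (K.iCycles _)]))
      { τ₁ := 𝟙 _, τ₂ := 𝟙 _, τ₃ := kernel.ι (K.homologyπ (n + 1)),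
        comm₂₃ := (Category.id_comp _).trans (toBoundaries_ι K (n + 1)).symm }).2
      (exact_iCycles_toCycles K n)
  mono_f := inferInstanceAs (Mono (K.iCycles n))
  epi_g := inferInstanceAs (Epi (toBoundaries K (n + 1)))

variable (J : CochainComplex (Rep.{0} k G) ℕ)

lemma isAcyclicRep_cycles (hJ : ∀ i, IsAcyclicRep (J.X i)) (h : ℕ)
    (hex : ∀ q, q ≠ h → J.ExactAt q) (q : ℕ) (hq : q < h) : IsAcyclicRep (J.cycles q) := by
  induction q with
  | zero =>
    refine .of_isZero ?_
    have := (exact_toCycles_homologyπ J 0).mono_g (by simp [← cancel_mono (J.iCycles _)])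
    exact IsZero.of_mono (J.homologyπ 0)
      ((HomologicalComplex.exactAt_iff_isZero_homology _ _).1 (hex 0 hq.ne))
  | succ q ih =>
    exact (shortExact_cycles J q (hex _ hq.ne)).isAcyclicRep_X₃ (ih (by lia)) (hJ q)

lemma isAcyclicRep_boundaries (hJ : ∀ i, IsAcyclicRep (J.X i)) (h : ℕ)
    (hex : ∀ q, q ≠ h → J.ExactAt q) : IsAcyclicRep (kernel (J.homologyπ h)) := by
  cases h with
  | zero =>
    refine .of_isZero ?_
    have h0 : toBoundaries J 0 = 0 := by
      rw [← cancel_mono (kernel.ι _), toBoundaries_ι]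
      simp [← cancel_mono (J.iCycles _)]
    exact IsZero.of_epi_eq_zero _ h0
  | succ h =>
    exact (shortExact_boundaries J h).isAcyclicRep_X₃
      (isAcyclicRep_cycles J hJ _ hex h (by lia)) (hJ h)

lemma isZero_groupCohomology_cycles_iff (hJ : ∀ i, IsAcyclicRep (J.X i)) (h : ℕ)
    (hex : ∀ q, q ≠ h → J.ExactAt q) (j m : ℕ) :
    IsZero (groupCohomology (J.cycles (h + j)) (m + 1)) ↔
      IsZero (groupCohomology (J.cycles h) (m + j + 1)) := by
  induction j generalizing m with
  | zero => rfl
  | succ j ih =>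
    rw [← add_assoc h, show m + (j + 1) + 1 = (m + 1) + j + 1 by lia, ← ih (m + 1)]
    exact (shortExact_cycles J (h + j) (hex _ (by lia))).isZero_groupCohomology_X₃_iff (hJ _) m

lemma exists_invariant_toBoundaries (hJ : ∀ i, IsAcyclicRep (J.X i)) (h : ℕ)
    (hex : ∀ q, q ≠ h → J.ExactAt q) (b : (kernel (J.homologyπ h) : Rep.{0} k G))
    (hb : ∀ g, (kernel (J.homologyπ h)).ρ g b = b) :
    ∃ y : J.X (h - 1), (∀ g, (J.X (h - 1)).ρ g y = y) ∧ (toBoundaries J h).hom y = b := by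
  cases h with
  | zero =>
    obtain ⟨y, rfl⟩ := (Rep.epi_iff_surjective (toBoundaries J 0)).1 inferInstance b
    have h0 : toBoundaries J 0 = 0 := by
      rw [← cancel_mono (kernel.ι _), toBoundaries_ι]
      simp [← cancel_mono (J.iCycles _)]
    refine ⟨0, fun g => map_zero _, ?_⟩
    rw [h0]
    rfl
  | succ h =>
    exact (shortExact_boundaries J h).exists_invariant_lift
      (isAcyclicRep_cycles J hJ _ hex h (by lia) 0) b hb

/-- If a complex of acyclic representations has cohomology only in degree `h`, the vanishing of
the group cohomology of this representation can be read off the complex of invariants. -/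
theorem isZero_groupCohomology_homology_iff (hJ : ∀ i, IsAcyclicRep (J.X i)) (h : ℕ)
    (hex : ∀ q, q ≠ h → J.ExactAt q) (p : ℕ) :
    IsZero (groupCohomology (J.homology h) p) ↔
      ∀ x : J.X (p + h), (∀ g, (J.X (p + h)).ρ g x = x) → (J.d (p + h) (p + h + 1)).hom x = 0 →
        ∃ y : J.X (p + h - 1), (∀ g, (J.X (p + h - 1)).ρ g y = y) ∧
          (J.d (p + h - 1) (p + h)).hom y = x := by
  have hiinj (n : ℕ) : Function.Injective (J.iCycles n).hom :=
    (Rep.mono_iff_injective _).1 inferInstance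
  have hcyc (n : ℕ) (x : J.X n) (hx : ∀ g, (J.X n).ρ g x = x) (hdx : (J.d n (n + 1)).hom x = 0) :
      ∃ z : J.cycles n, (∀ g, (J.cycles n).ρ g z = z) ∧ (J.iCycles n).hom z = x := by
    obtain ⟨z, rfl⟩ := (rep_exact_iff _).1 (exact_iCycles_d J n) x hdx
    refine ⟨z, fun g => hiinj n ?_, rfl⟩
    rw [Rep.hom_comm_apply]
    exact hx g
  have hinv (n : ℕ) (z : J.cycles n) (hz : ∀ g, (J.cycles n).ρ g z = z) (g : G) :
      (J.X n).ρ g ((J.iCycles n).hom z) = (J.iCycles n).hom z := by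
    rw [← Rep.hom_comm_apply, hz]
  have hdi (n : ℕ) (z : J.cycles n) : (J.d n (n + 1)).hom ((J.iCycles n).hom z) = 0 :=
    congr(($(J.iCycles_d n (n + 1))).hom z)
  have hti (m n : ℕ) (y : J.X m) : (J.iCycles n).hom ((J.toCycles m n).hom y) = (J.d m n).hom y :=
    congr(($(J.toCycles_i m n)).hom y)
  have hB := isAcyclicRep_boundaries J hJ h hex
  have hS := shortExact_kernel (J.homologyπ h)
  cases p with
  | zero =>
    rw [isZero_groupCohomology_zero_iff, Nat.zero_add]
    constructor
    · intro hH x hx hdx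
      obtain ⟨z, hz, rfl⟩ := hcyc _ x hx hdx
      have hπ : (J.homologyπ h).hom z = 0 := hH _ fun g => by rw [← Rep.hom_comm_apply, hz]
      obtain ⟨b, rfl⟩ := (rep_exact_iff _).1 hS.exact z hπ
      have hιinj : Function.Injective (kernel.ι (J.homologyπ h)).hom :=
        (Rep.mono_iff_injective _).1 inferInstance
      obtain ⟨y, hy, rfl⟩ := exists_invariant_toBoundaries J hJ h hex b fun g => hιinj (by
        rw [Rep.hom_comm_apply]
        exact hz g)
      refine ⟨y, hy, ?_⟩
      rw [← hti, ← toBoundaries_ι]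
      rfl
    · intro hx w hw
      obtain ⟨z, hz, rfl⟩ := hS.exists_invariant_lift (hB 0) w hw
      obtain ⟨y, hy, hyz⟩ := hx _ (hinv _ z hz) (hdi _ z)
      rw [← hti] at hyz
      rw [← hiinj _ hyz]
      exact congr(($(J.toCycles_comp_homologyπ (h - 1) h)).hom y)
  | succ p =>
    rw [← hS.isZero_groupCohomology_X₂_iff hB, ← Nat.zero_add p,
      ← isZero_groupCohomology_cycles_iff J hJ h hex]
    have hT := shortExact_cycles J (h + p) (hex _ (by lia))
    rw [show 0 + p + 1 + h = h + p + 1 by lia, Nat.zero_add,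
      hT.isZero_groupCohomology_one_iff (hJ _)]
    constructor
    · intro H x hx hdx
      obtain ⟨z, hz, rfl⟩ := hcyc _ x hx hdx
      obtain ⟨y, hy, rfl⟩ := H z hz
      exact ⟨y, hy, (hti _ _ y).symm⟩
    · intro H z hz
      obtain ⟨y, hy, hyz⟩ := H _ (hinv _ z hz) (hdi _ z)
      exact ⟨y, hy, hiinj _ ((hti _ _ y).trans hyz)⟩

end Collapse

section ConjHom
variable {k G : Type} [CommRing k] [Group G] (N : Subgroup G)

/-- Restriction of representations to a subgroup. -/
noncomputable abbrev resSub : Rep.{0} k G ⥤ Rep.{0} k N := Rep.resFunctor N.subtype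

variable {N} {A A' B : Rep.{0} k G}

lemma resHom_ext {f f' : (resSub N).obj A ⟶ (resSub N).obj B}
    (h : ∀ a : A, f.hom a = f'.hom a) : f = f' :=
  Rep.hom_ext (Representation.IntertwiningMap.ext (LinearMap.ext h))

lemma resHom_comm (f : (resSub N).obj A ⟶ (resSub N).obj B) {n : G} (hn : n ∈ N) (a : A) :
    f.hom (A.ρ n a) = B.ρ n (f.hom a) :=
  Rep.hom_comm_apply f ⟨n, hn⟩ a

/-- The morphism of restrictions given by a linear map commuting with the subgroup. -/
noncomputable def resHomMk (f : A →ₗ[k] B) (hf : ∀ n ∈ N, ∀ a, f (A.ρ n a) = B.ρ n (f a)) :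
    (resSub N).obj A ⟶ (resSub N).obj B :=
  Rep.ofHom ⟨f, fun n => LinearMap.ext (hf n.1 n.2)⟩

variable [N.Normal]

/-- Conjugation by `g` of a homomorphism equivariant for a normal subgroup. -/
noncomputable def conjHom (g : G) (f : (resSub N).obj A ⟶ (resSub N).obj B) :
    (resSub N).obj A ⟶ (resSub N).obj B :=
  resHomMk (B.ρ g ∘ₗ f.hom.toLinearMap ∘ₗ A.ρ g⁻¹) fun n hn a => by
    change B.ρ g (f.hom (A.ρ g⁻¹ (A.ρ n a))) = B.ρ n (B.ρ g (f.hom (A.ρ g⁻¹ a)))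
    rw [← Module.End.mul_apply, ← map_mul, ← Module.End.mul_apply (B.ρ n), ← map_mul,
      show g⁻¹ * n = (g⁻¹ * n * g) * g⁻¹ by group, map_mul, Module.End.mul_apply,
      resHom_comm f (by simpa using Subgroup.Normal.conj_mem ‹_› n hn g⁻¹),
      ← Module.End.mul_apply, ← map_mul]
    congr 2
    group

lemma conjHom_apply (g : G) (f : (resSub N).obj A ⟶ (resSub N).obj B) (a : A) :
    (conjHom g f).hom a = B.ρ g (f.hom (A.ρ g⁻¹ a)) := rfl

variable (N A B) in
/-- The conjugation action on homomorphisms equivariant for a normal subgroup. -/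
noncomputable def conjRep : Representation k G ((resSub N).obj A ⟶ (resSub N).obj B) where
  toFun g :=
    { toFun := conjHom g
      map_add' f f' := resHom_ext fun a => map_add (B.ρ g) _ _
      map_smul' r f := resHom_ext fun a => map_smul (B.ρ g) _ _ }
  map_one' := LinearMap.ext fun f => resHom_ext fun a => by
    change B.ρ 1 (f.hom (A.ρ 1⁻¹ a)) = f.hom a
    simp
  map_mul' g g' := LinearMap.ext fun f => resHom_ext fun a => by
    change B.ρ (g * g') (f.hom (A.ρ (g * g')⁻¹ a)) = B.ρ g (B.ρ g' (f.hom (A.ρ g'⁻¹ (A.ρ g⁻¹ a))))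
    simp

lemma conjHom_mul (g g' : G) (f : (resSub N).obj A ⟶ (resSub N).obj B) :
    conjHom (g * g') f = conjHom g (conjHom g' f) :=
  congr($((conjRep N A B).map_mul g g') f)

lemma conjHom_one (f : (resSub N).obj A ⟶ (resSub N).obj B) : conjHom 1 f = f :=
  congr($((conjRep N A B).map_one) f)

lemma conjHom_of_mem {n : G} (hn : n ∈ N) (f : (resSub N).obj A ⟶ (resSub N).obj B) :
    conjHom n f = f := resHom_ext fun a => by
  rw [conjHom_apply, resHom_comm f (inv_mem hn)]
  simp

lemma map_comp_conjHom (φ : A ⟶ A') (g : G) (f : (resSub N).obj A' ⟶ (resSub N).obj B) :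
    (resSub N).map φ ≫ conjHom g f = conjHom g ((resSub N).map φ ≫ f) := resHom_ext fun a => by
  change B.ρ g (f.hom (A'.ρ g⁻¹ (φ.hom a))) = B.ρ g (f.hom (φ.hom (A.ρ g⁻¹ a)))
  rw [Rep.hom_comm_apply]

instance : Representation.IsTrivial ((conjRep N A B).comp N.subtype) where
  out n := LinearMap.ext fun f => conjHom_of_mem n.2 f

variable (N A B) in
/-- The representation of the quotient group on homomorphisms equivariant for a normal
subgroup. -/
noncomputable def homRep : Rep.{0} k (G ⧸ N) := Rep.of ((conjRep N A B).ofQuotient N)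

lemma homRep_ρ_mk (g : G) (f : (resSub N).obj A ⟶ (resSub N).obj B) :
    (homRep N A B).ρ (QuotientGroup.mk g) f = conjHom g f := rfl

variable (B) in
/-- Precomposition as a morphism of representations. -/
noncomputable def homRepMap (φ : A ⟶ A') : homRep N A' B ⟶ homRep N A B :=
  Rep.ofHom ⟨Linear.leftComp k _ ((resSub N).map φ), fun q => by
    induction q using QuotientGroup.induction_on with
    | H g => exact LinearMap.ext fun f => map_comp_conjHom φ g f⟩

lemma homRep_invariant_iff (f : (resSub N).obj A ⟶ (resSub N).obj B) :
    (∀ q, (homRep N A B).ρ q f = f) ↔ ∃ F : A ⟶ B, (resSub N).map F = f := by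
  constructor
  · intro h
    refine ⟨Rep.ofHom ⟨f.hom.toLinearMap, fun g => LinearMap.ext fun a => ?_⟩, rfl⟩
    have h1 := congr(($(h (QuotientGroup.mk g))).hom (A.ρ g a))
    rw [homRep_ρ_mk, conjHom_apply, ← Module.End.mul_apply (A.ρ g⁻¹), ← map_mul] at h1
    simpa using h1.symm
  · rintro ⟨F, rfl⟩ q
    induction q using QuotientGroup.induction_on with
    | H g =>
      rw [homRep_ρ_mk]
      refine resHom_ext fun a => ?_
      change B.ρ g (F.hom (A.ρ g⁻¹ a)) = F.hom a
      rw [Rep.hom_comm_apply]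
      simp

variable (N) in
/-- The complex of homomorphisms equivariant for a normal subgroup, with its action of the
quotient group. -/
noncomputable def homRepComplex (P : ChainComplex (Rep.{0} k G) ℕ) (B : Rep.{0} k G) :
    CochainComplex (Rep.{0} k (G ⧸ N)) ℕ where
  X i := homRep N (P.X i) B
  d i j := homRepMap B (P.d j i)
  shape i j hij := Rep.hom_ext (Representation.IntertwiningMap.ext (LinearMap.ext
    fun (f : (resSub N).obj (P.X i) ⟶ (resSub N).obj B) => by
    change (resSub N).map (P.d j i) ≫ f = 0
    rw [P.shape j i hij, Functor.map_zero, zero_comp]))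
  d_comp_d' i j l _ _ := Rep.hom_ext (Representation.IntertwiningMap.ext (LinearMap.ext
    fun (f : (resSub N).obj (P.X i) ⟶ (resSub N).obj B) => by
    change (resSub N).map (P.d l j) ≫ (resSub N).map (P.d j i) ≫ f = 0
    rw [← Category.assoc, ← Functor.map_comp, P.d_comp_d, Functor.map_zero, zero_comp]))

end ConjHom

section
variable {k G : Type} [CommRing k] [Group G] (N : Subgroup G)

lemma ofMulAction_resHom_ext {X : Type} [MulAction G X] {B : Rep.{0} k G}
    {f f' : (resSub N).obj (Rep.ofMulAction k G X) ⟶ (resSub N).obj B}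
    (h : ∀ x, f.hom (MonoidAlgebra.single x (1 : k)) = f'.hom (MonoidAlgebra.single x (1 : k))) :
    f = f' :=
  resHom_ext (eq_of_basis (f := f.hom.toLinearMap) (g := f'.hom.toLinearMap) h)

lemma ofMulAction_ρ_single {X : Type} [MulAction G X] (g : G) (x : X) :
    (Rep.ofMulAction k G X).ρ g (MonoidAlgebra.single x (1 : k)) =
      MonoidAlgebra.single (g • x) (1 : k) :=
  Representation.ofMulAction_single g x (1 : k)

lemma exists_ofMulAction_resHom {X : Type} [MulAction G X] {B : Rep.{0} k G} (ψ : X → B)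
    (hψ : ∀ g ∈ N, ∀ x, ψ (g • x) = B.ρ g (ψ x)) :
    ∃ f : (resSub N).obj (Rep.ofMulAction k G X) ⟶ (resSub N).obj B,
      ∀ x, f.hom (MonoidAlgebra.single x (1 : k)) = ψ x := by
  have hb (x : X) : basisLift ψ (MonoidAlgebra.single x (1 : k)) = ψ x := by simp
  refine ⟨resHomMk (A := Rep.ofMulAction k G X) (basisLift ψ) fun g hg a => ?_, hb⟩
  refine eq_of_basis (f := basisLift ψ ∘ₗ (Rep.ofMulAction k G X).ρ g)
    (g := B.ρ g ∘ₗ basisLift ψ) (fun x => ?_) a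
  rw [LinearMap.comp_apply, LinearMap.comp_apply, ofMulAction_ρ_single, hb, hb, hψ g hg]

variable [N.Normal]

theorem isAcyclicRep_homRep_ofMulAction {X : Type} [MulAction G X] (τ : X → G)
    (hτ : ∀ (g : G) x, τ (g • x) = g * τ x) (B : Rep.{0} k G) :
    IsAcyclicRep (homRep N (Rep.ofMulAction k G X) B) := by
  intro m
  rw [ModuleCat.isZero_iff_subsingleton]
  have hex (φ : G ⧸ N → ((resSub N).obj (Rep.ofMulAction k G X) ⟶ (resSub N).obj B)) :
      ∃ f : (resSub N).obj (Rep.ofMulAction k G X) ⟶ (resSub N).obj B,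
        ∀ x, f.hom (MonoidAlgebra.single x (1 : k)) =
          (φ (QuotientGroup.mk (τ x))).hom (MonoidAlgebra.single x (1 : k)) := by
    refine exists_ofMulAction_resHom N _ fun g hg x => ?_
    have : (QuotientGroup.mk (τ (g • x)) : G ⧸ N) = QuotientGroup.mk (τ x) := by
      rw [hτ, QuotientGroup.mk_mul, (QuotientGroup.eq_one_iff g).2 hg, one_mul]
    rw [this, ← resHom_comm _ hg, ofMulAction_ρ_single]
  choose E hE using hex
  obtain ⟨E', hE'⟩ : ∃ E' : (G ⧸ N → homRep N (Rep.ofMulAction k G X) B) →ₗ[k]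
      homRep N (Rep.ofMulAction k G X) B, ∀ φ, E' φ = E φ :=
    ⟨{ toFun := E
       map_add' φ ψ := ofMulAction_resHom_ext N fun x =>
        (hE _ x).trans congr($((hE φ x).symm) + $((hE ψ x).symm))
       map_smul' r φ := ofMulAction_resHom_ext N fun x =>
        (hE _ x).trans congr(r • $((hE φ x).symm)) }, fun _ => rfl⟩
  refine subsingleton_groupCohomology_succ_of_mean _ E' (fun v => ?_) (fun q φ => ?_) m
  · rw [hE']
    exact ofMulAction_resHom_ext N (hE _)
  · induction q using QuotientGroup.induction_on with
    | H g =>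
      rw [hE', hE', homRep_ρ_mk]
      refine ofMulAction_resHom_ext N fun x => (hE _ x).trans ?_
      refine Eq.trans (conjHom_apply g _ _) ?_
      rw [conjHom_apply, ofMulAction_ρ_single]
      refine congr(B.ρ g $((hE φ (g⁻¹ • x)).trans ?_)).symm
      rw [hτ]
      rfl

theorem isAcyclicRep_homRep_standardComplex (n : ℕ) (B : Rep.{0} k G) :
    IsAcyclicRep (homRep N ((Rep.standardComplex k G).X n) B) :=
  isAcyclicRep_homRep_ofMulAction N (X := Fin (n + 1) → G) (fun x => x 0) (fun _ _ => rfl) B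

theorem subsingleton_groupCohomology_iff_invariants
    (P : ProjectiveResolution (Rep.trivial k G k)) (B : Rep.{0} k G) (n : ℕ) :
    (∀ x : (homRepComplex N P.complex B).X n,
      (∀ q, ((homRepComplex N P.complex B).X n).ρ q x = x) →
      ((homRepComplex N P.complex B).d n (n + 1)).hom x = 0 →
        ∃ y : (homRepComplex N P.complex B).X (n - 1),
          (∀ q, ((homRepComplex N P.complex B).X (n - 1)).ρ q y = y) ∧
          ((homRepComplex N P.complex B).d (n - 1) n).hom y = x) ↔
    Subsingleton (groupCohomology B n) := by
  rw [subsingleton_groupCohomology_iff P]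
  constructor
  · intro H f hf
    obtain ⟨y, hy, hyf⟩ := H ((resSub N).map f) ((homRep_invariant_iff _).2 ⟨f, rfl⟩) (by
      change (resSub N).map (P.complex.d (n + 1) n) ≫ (resSub N).map f = 0
      rw [← Functor.map_comp, hf, Functor.map_zero])
    obtain ⟨g, rfl⟩ := (homRep_invariant_iff _).1 hy
    refine ⟨g, (resSub N).map_injective ?_⟩
    rw [Functor.map_comp]
    exact hyf
  · intro H x hx hdx
    obtain ⟨f, rfl⟩ := (homRep_invariant_iff _).1 hx
    obtain ⟨g, rfl⟩ := H f ((resSub N).map_injective (by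
      rw [Functor.map_comp, Functor.map_zero]
      exact hdx))
    exact ⟨(resSub N).map g, (homRep_invariant_iff _).2 ⟨g, rfl⟩,
      ((resSub N).map_comp _ _).symm⟩

end

section CosetProj
variable {k G : Type} [CommRing k] [Group G] (N : Subgroup G)

section Normal
variable [N.Normal]

open Classical in
lemma exists_cosetProj (q : G ⧸ N) :
    ∃ f : (resSub N).obj (Rep.leftRegular k G) ⟶ (resSub N).obj (Rep.leftRegular k G),
      ∀ x : G, f.hom (MonoidAlgebra.single x (1 : k)) =
        if (QuotientGroup.mk x : G ⧸ N) = q then MonoidAlgebra.single x (1 : k) else 0 := by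
  refine exists_ofMulAction_resHom N (X := G) (B := Rep.leftRegular k G) _ fun g hg x => ?_
  have : (QuotientGroup.mk (g • x) : G ⧸ N) = QuotientGroup.mk x := by
    rw [smul_eq_mul, QuotientGroup.mk_mul, (QuotientGroup.eq_one_iff g).2 hg, one_mul]
  rw [this]
  split_ifs
  · exact (ofMulAction_ρ_single (k := k) (X := G) g x).symm
  · exact (map_zero ((Rep.leftRegular k G).ρ g)).symm

/-- The projection of the regular representation onto the span of a coset. -/
noncomputable def cosetProj (q : G ⧸ N) :
    (resSub N).obj (Rep.leftRegular k G) ⟶ (resSub N).obj (Rep.leftRegular k G) :=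
  (exists_cosetProj N q).choose

lemma cosetProj_single_mk (x : G) :
    (cosetProj (k := k) N (QuotientGroup.mk x)).hom (MonoidAlgebra.single x (1 : k)) =
      MonoidAlgebra.single x (1 : k) :=
  ((exists_cosetProj N _).choose_spec x).trans (if_pos rfl)

lemma cosetProj_single_of_ne {q : G ⧸ N} {x : G} (h : QuotientGroup.mk x ≠ q) :
    (cosetProj (k := k) N q).hom (MonoidAlgebra.single x (1 : k)) = 0 :=
  ((exists_cosetProj N q).choose_spec x).trans (if_neg h)

lemma cosetProj_comp_of_ne {q q' : G ⧸ N} (hq : q ≠ q') :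
    cosetProj (k := k) N q ≫ cosetProj N q' = 0 :=
  ofMulAction_resHom_ext N (X := G) fun x => by
    change (cosetProj N q').hom ((cosetProj N q).hom _) = 0
    by_cases h : QuotientGroup.mk x = q
    · subst h
      refine (congrArg _ (cosetProj_single_mk N x)).trans (cosetProj_single_of_ne N hq)
    · refine (congrArg _ (cosetProj_single_of_ne N h)).trans (map_zero _)

lemma ρ_cosetProj (g : G) (q : G ⧸ N) (v : Rep.leftRegular k G) :
    (Rep.leftRegular k G).ρ g ((cosetProj N q).hom v) =
      (cosetProj N (QuotientGroup.mk g * q)).hom ((Rep.leftRegular k G).ρ g v) := by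
  refine eq_of_basis (f := (Rep.leftRegular k G).ρ g ∘ₗ (cosetProj N q).hom.toLinearMap)
    (g := (cosetProj N (QuotientGroup.mk g * q)).hom.toLinearMap ∘ₗ (Rep.leftRegular k G).ρ g)
    (fun x => ?_) v
  change (Rep.leftRegular k G).ρ g ((cosetProj N q).hom _) =
      (cosetProj N (QuotientGroup.mk g * q)).hom ((Rep.leftRegular k G).ρ g _)
  by_cases h : QuotientGroup.mk x = q
  · subst h
    refine (congrArg _ (cosetProj_single_mk N x)).trans ?_
    refine Eq.trans ?_ (congrArg _ (ofMulAction_ρ_single (X := G) g x)).symm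
    refine (ofMulAction_ρ_single (X := G) g x).trans ?_
    exact (cosetProj_single_mk N (g * x)).symm
  · refine (congrArg _ (cosetProj_single_of_ne N h)).trans ?_
    refine Eq.trans ?_ (congrArg _ (ofMulAction_ρ_single (X := G) g x)).symm
    refine (map_zero ((Rep.leftRegular k G).ρ g)).trans (cosetProj_single_of_ne N ?_).symm
    rw [smul_eq_mul, QuotientGroup.mk_mul]
    exact fun h' => h (mul_left_cancel h')

lemma conjHom_comp_cosetProj {A : Rep.{0} k G} (g : G) (q : G ⧸ N)
    (f : (resSub N).obj A ⟶ (resSub N).obj (Rep.leftRegular k G)) :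
    conjHom g (f ≫ cosetProj N q) = conjHom g f ≫ cosetProj N (QuotientGroup.mk g * q) :=
  resHom_ext fun _ => ρ_cosetProj N g q _

lemma exists_sum_cosetProj (v : Rep.leftRegular k G) :
    ∃ S : Finset (G ⧸ N), ∀ T, S ⊆ T → ∑ q ∈ T, (cosetProj N q).hom v = v := by
  classical
  have : ∀ v : MonoidAlgebra k G, ∃ S : Finset (G ⧸ N), ∀ T, S ⊆ T →
      ∑ q ∈ T, (cosetProj (k := k) N q).hom.toLinearMap v = v := by
    intro v
    induction v using MonoidAlgebra.induction_linear with
    | zero => exact ⟨∅, fun T _ => Finset.sum_eq_zero fun q _ => map_zero _⟩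
    | add v w hv hw =>
      obtain ⟨S, hS⟩ := hv
      obtain ⟨S', hS'⟩ := hw
      refine ⟨S ∪ S', fun T hT => ?_⟩
      refine (Finset.sum_congr rfl fun q _ => map_add _ v w).trans ?_
      refine Finset.sum_add_distrib.trans ?_
      exact congr($(hS T (Finset.union_subset_left hT)) + $(hS' T (Finset.union_subset_right hT)))
    | single x r =>
      refine ⟨{QuotientGroup.mk x}, fun T hT => ?_⟩
      have hr : MonoidAlgebra.single x r = r • MonoidAlgebra.single x (1 : k) := by simp
      rw [hr]
      refine (Finset.sum_congr rfl fun q _ => map_smul _ r _).trans ?_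
      refine Finset.smul_sum.symm.trans (congrArg (r • ·) ?_)
      refine (Finset.sum_eq_single_of_mem _ (hT (Finset.mem_singleton_self _))
        fun q _ hq => ?_).trans (cosetProj_single_mk N x)
      exact cosetProj_single_of_ne N hq.symm
  exact this v

end Normal

/-- The inclusion of the regular representation of a subgroup. -/
noncomputable def subInclusion :
    Rep.leftRegular k N ⟶ (resSub N).obj (Rep.leftRegular k G) :=
  Rep.leftRegularHom _ (MonoidAlgebra.single (1 : G) (1 : k) : Rep.leftRegular k G)

lemma subInclusion_single (n : N) :
    (subInclusion (k := k) N).hom (MonoidAlgebra.single n (1 : k)) =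
      (MonoidAlgebra.single (n : G) (1 : k) : Rep.leftRegular k G) := by
  refine (Rep.leftRegularHom_hom_single n _ 1).trans ((one_smul _ _).trans ?_)
  refine (ofMulAction_ρ_single (X := G) (n : G) 1).trans ?_
  simp

open Classical in
lemma exists_subProjection :
    ∃ f : (resSub N).obj (Rep.leftRegular k G) ⟶ Rep.leftRegular k N,
      ∀ x : G, f.hom (MonoidAlgebra.single x (1 : k)) =
        if h : x ∈ N then MonoidAlgebra.single ⟨x, h⟩ (1 : k) else 0 := by
  let ψ : G → MonoidAlgebra k N := fun x =>
    if h : x ∈ N then MonoidAlgebra.single ⟨x, h⟩ (1 : k) else 0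
  have hb (x : G) : basisLift ψ (MonoidAlgebra.single x (1 : k)) = ψ x := by simp
  refine ⟨Rep.ofHom ⟨basisLift ψ, fun n => LinearMap.ext fun a => ?_⟩, hb⟩
  refine eq_of_basis (f := basisLift ψ ∘ₗ (Rep.leftRegular k G).ρ n)
    (g := (Rep.leftRegular k N).ρ n ∘ₗ basisLift ψ) (fun x => ?_) a
  rw [LinearMap.comp_apply, LinearMap.comp_apply, hb]
  refine (congrArg _ (ofMulAction_ρ_single (X := G) (n : G) x)).trans ((hb _).trans ?_)
  by_cases h : x ∈ N
  · have h' : (n : G) • x ∈ N := mul_mem n.2 h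
    refine (dif_pos h').trans ?_
    refine Eq.trans ?_ (congrArg _ (dif_pos h)).symm
    exact (ofMulAction_ρ_single (X := N) n ⟨x, h⟩).symm
  · have h' : ¬ (n : G) • x ∈ N := fun h' => h ((mul_mem_cancel_left n.2).1 h')
    refine (dif_neg h').trans ?_
    refine Eq.trans ?_ (congrArg _ (dif_neg h)).symm
    exact (map_zero ((Rep.leftRegular k N).ρ n)).symm

/-- The projection onto the regular representation of a subgroup. -/
noncomputable def subProjection :
    (resSub N).obj (Rep.leftRegular k G) ⟶ Rep.leftRegular k N :=
  (exists_subProjection N).choose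

lemma subProjection_single (n : N) :
    (subProjection (k := k) N).hom (MonoidAlgebra.single (n : G) (1 : k)) =
      MonoidAlgebra.single n (1 : k) :=
  ((exists_subProjection N).choose_spec n).trans (dif_pos n.2)

lemma subProjection_single_of_notMem {x : G} (hx : x ∉ N) :
    (subProjection (k := k) N).hom (MonoidAlgebra.single x (1 : k)) = 0 :=
  ((exists_subProjection N).choose_spec x).trans (dif_neg hx)

lemma subInclusion_subProjection : subInclusion (k := k) N ≫ subProjection N = 𝟙 _ :=
  Rep.hom_ext (Representation.IntertwiningMap.ext (LinearMap.ext (eq_of_basis fun n =>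
    (congrArg _ (subInclusion_single N n)).trans (subProjection_single N n))))

variable [N.Normal]

lemma subProjection_subInclusion : subProjection (k := k) N ≫ subInclusion N = cosetProj N 1 :=
  ofMulAction_resHom_ext N (X := G) fun x => by
    change (subInclusion (k := k) N).hom ((subProjection (k := k) N).hom _) = _
    by_cases hx : x ∈ N
    · refine (congrArg _ (subProjection_single N ⟨x, hx⟩)).trans ?_
      refine (subInclusion_single N ⟨x, hx⟩).trans ?_
      rw [← (QuotientGroup.eq_one_iff x).2 hx]
      exact (cosetProj_single_mk N x).symm
    · refine (congrArg _ (subProjection_single_of_notMem N hx)).trans ((map_zero _).trans ?_)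
      exact (cosetProj_single_of_ne N fun h => hx ((QuotientGroup.eq_one_iff x).1 h)).symm

lemma subInclusion_cosetProj_one : subInclusion (k := k) N ≫ cosetProj N 1 = subInclusion N := by
  rw [← subProjection_subInclusion, ← Category.assoc, subInclusion_subProjection, Category.id_comp]

end CosetProj

theorem CategoryTheory.ProjectiveResolution.exists_factor_of_cocycle
    {C : Type*} [Category C] [Abelian C]
    {Z : C} (R Q : ProjectiveResolution Z) (n : ℕ) :
    ∃ (a : R.complex.X n ⟶ Q.complex.X n) (b : Q.complex.X n ⟶ R.complex.X n),
      ∀ (B : C) (F : R.complex.X n ⟶ B), R.complex.d (n + 1) n ≫ F = 0 →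
        ∃ H : R.complex.X (n - 1) ⟶ B, F = a ≫ b ≫ F + R.complex.d n (n - 1) ≫ H := by
  let e := ProjectiveResolution.homotopyEquiv R Q
  refine ⟨e.hom.f n, e.inv.f n, fun B F hF => ?_⟩
  have h := e.homotopyHomInvId.comm n
  rw [dNext_nat, Homotopy.prevD_chainComplex] at h
  refine ⟨- e.homotopyHomInvId.hom (n - 1) n ≫ F, ?_⟩
  have h2 := congr($h ≫ F)
  simp only [HomologicalComplex.comp_f, Category.assoc, Preadditive.add_comp, hF, comp_zero,
    add_zero, HomologicalComplex.id_f, Category.id_comp] at h2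
  rw [h2]
  simp

section Finiteness
variable {k G : Type} [CommRing k] [Group G]

/-- Evaluation of morphisms of representations at a vector. -/
noncomputable def evalHom {V : Rep.{0} k G} (W : Rep.{0} k G) (v : V) : (V ⟶ W) →+ W where
  toFun f := f.hom v
  map_zero' := rfl
  map_add' _ _ := rfl

lemma exists_finset_forall_hom_eq_zero (V : Rep.{0} k G) [Module.Finite (MonoidAlgebra k G)
      (Rep.equivalenceModuleMonoidAlgebra.functor.obj V)] :
    ∃ s : Finset V, ∀ (W : Rep.{0} k G) (D : V ⟶ W), (∀ v ∈ s, D.hom v = 0) → D = 0 := by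
  obtain ⟨s, hs⟩ := Module.Finite.fg_top (R := MonoidAlgebra k G)
    (M := Rep.equivalenceModuleMonoidAlgebra.functor.obj V)
  refine ⟨s, fun W D hD => ?_⟩
  apply Rep.equivalenceModuleMonoidAlgebra.functor.map_injective
  rw [Functor.map_zero]
  exact ModuleCat.hom_ext (LinearMap.ext_on hs fun v hv => hD v hv)

variable (N : Subgroup G) [N.Normal]

theorem exists_eq_sum_cosetProj (V : Rep.{0} k N) [Module.Finite (MonoidAlgebra k N)
      (Rep.equivalenceModuleMonoidAlgebra.functor.obj V)]
    (F : V ⟶ (resSub N).obj (Rep.leftRegular k G)) :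
    ∃ S : Finset (G ⧸ N), F = ∑ q ∈ S, F ≫ cosetProj N q := by
  classical
  obtain ⟨s, hs⟩ := exists_finset_forall_hom_eq_zero V
  choose S hS using exists_sum_cosetProj (k := k) N
  refine ⟨s.biUnion fun v => S (F.hom v), ?_⟩
  rw [← sub_eq_zero]
  refine hs _ _ fun v hv => ?_
  refine (map_sub (evalHom ((resSub N).obj (Rep.leftRegular k G)) v) _ _).trans ?_
  rw [map_sum, sub_eq_zero]
  exact (hS (F.hom v) _ (Finset.subset_biUnion_of_mem (fun v => S (F.hom v)) hv)).symm

theorem exists_eq_sum_cosetProj_add (R Q : ProjectiveResolution (Rep.trivial k N k)) (n : ℕ)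
    [Module.Finite (MonoidAlgebra k N)
      (Rep.equivalenceModuleMonoidAlgebra.functor.obj (Q.complex.X n))]
    (F : R.complex.X n ⟶ (resSub N).obj (Rep.leftRegular k G))
    (hF : R.complex.d (n + 1) n ≫ F = 0) :
    ∃ (S : Finset (G ⧸ N)) (E : R.complex.X (n - 1) ⟶ (resSub N).obj (Rep.leftRegular k G)),
      F = ∑ q ∈ S, F ≫ cosetProj N q + R.complex.d n (n - 1) ≫ E := by
  obtain ⟨a, b, hab⟩ := ProjectiveResolution.exists_factor_of_cocycle R Q n
  obtain ⟨H, hH⟩ := hab _ F hF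
  obtain ⟨S, hS⟩ := exists_eq_sum_cosetProj N _ (b ≫ F)
  have hc (q : G ⧸ N) : R.complex.d (n + 1) n ≫ F ≫ cosetProj N q = 0 := by
    rw [← Category.assoc, hF, zero_comp]
  choose E hE using fun q => hab _ (F ≫ cosetProj N q) (hc q)
  refine ⟨S, H - ∑ q ∈ S, E q, ?_⟩
  have h1 : ∑ q ∈ S, F ≫ cosetProj N q = a ≫ b ≫ F + R.complex.d n (n - 1) ≫ ∑ q ∈ S, E q := by
    rw [Finset.sum_congr rfl fun q _ => hE q, Finset.sum_add_distrib, Preadditive.comp_sum,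
      hS, Preadditive.comp_sum]
    simp only [Category.assoc]
  rw [h1, Preadditive.comp_sub]
  refine hH.trans ?_
  abel

end Finiteness

section
variable {k G : Type} [CommRing k] [Group G]

theorem nonempty_iso_homology (J : CochainComplex (Rep.{0} k G) ℕ) (h : ℕ) {L : Rep.{0} k G}
    (φ : L ⟶ J.X h) (hφ : φ ≫ J.d h (h + 1) = 0)
    (hsurj : ∀ x : J.X h, (J.d h (h + 1)).hom x = 0 →
      ∃ (v : L) (y : J.X (h - 1)), x = φ.hom v + (J.d (h - 1) h).hom y)
    (hinj : ∀ (v : L) (y : J.X (h - 1)), φ.hom v = (J.d (h - 1) h).hom y → v = 0) :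
    Nonempty (L ≅ J.homology h) := by
  let w : L ⟶ J.cycles h := J.liftCycles φ (h + 1) (by simp) hφ
  have hw (v : L) : (J.iCycles h).hom (w.hom v) = φ.hom v :=
    congr(($(J.liftCycles_i φ (h + 1) (by simp) hφ)).hom v)
  have hto (y : J.X (h - 1)) :
      (J.iCycles h).hom ((J.toCycles (h - 1) h).hom y) = (J.d (h - 1) h).hom y :=
    congr(($(J.toCycles_i (h - 1) h)).hom y)
  have hi : Function.Injective (J.iCycles h).hom := (Rep.mono_iff_injective _).1 inferInstance
  have hπ : Function.Surjective (J.homologyπ h).hom := (Rep.epi_iff_surjective _).1 inferInstance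
  have hmono : Mono (w ≫ J.homologyπ h) := by
    rw [Rep.mono_iff_injective, injective_iff_map_eq_zero]
    intro v hv
    obtain ⟨y, hy⟩ := (rep_exact_iff _).1 (exact_toCycles_homologyπ J h) (w.hom v) hv
    exact hinj v y ((hw v).symm.trans ((congrArg _ hy.symm).trans (hto y)))
  have hepi : Epi (w ≫ J.homologyπ h) := by
    rw [Rep.epi_iff_surjective]
    intro x
    obtain ⟨c, rfl⟩ := hπ x
    obtain ⟨v, y, hvy⟩ := hsurj ((J.iCycles h).hom c) congr(($(J.iCycles_d h (h + 1))).hom c)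
    refine ⟨v, ?_⟩
    have hc : c = w.hom v + (J.toCycles (h - 1) h).hom y :=
      hi (by rw [map_add, hw, hto]; exact hvy)
    rw [hc, map_add]
    refine (add_zero _).symm.trans (congrArg _ ?_)
    exact congr(($(J.toCycles_comp_homologyπ (h - 1) h)).hom y).symm
  have := isIso_of_mono_of_epi (w ≫ J.homologyπ h)
  exact ⟨asIso (w ≫ J.homologyπ h)⟩

variable (N : Subgroup G) [N.Normal] {A A' : Rep.{0} k G}

lemma comp_cosetProj_mk (g : G)
    (F : (resSub N).obj A ⟶ (resSub N).obj (Rep.leftRegular k G)) :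
    F ≫ cosetProj N (QuotientGroup.mk g) =
      conjHom g ((conjHom g⁻¹ F ≫ subProjection N) ≫ subInclusion N) := by
  rw [Category.assoc, subProjection_subInclusion, conjHom_comp_cosetProj, ← conjHom_mul,
    mul_inv_cancel, conjHom_one, mul_one]

lemma map_comp_conjHom_comp_subProjection {φ : A' ⟶ A}
    {F : (resSub N).obj A ⟶ (resSub N).obj (Rep.leftRegular k G)}
    (hF : (resSub N).map φ ≫ F = 0) (g : G) :
    (resSub N).map φ ≫ conjHom g F ≫ subProjection N = 0 := by
  rw [← Category.assoc, map_comp_conjHom, hF]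
  have : conjHom g (0 : (resSub N).obj A' ⟶ (resSub N).obj (Rep.leftRegular k G)) = 0 :=
    map_zero (conjRep N A' (Rep.leftRegular k G) g)
  rw [this, zero_comp]

lemma conjHom_smul_add {B : Rep.{0} k G} (g : G) (m : k)
    (f f' : (resSub N).obj A ⟶ (resSub N).obj B) :
    conjHom g (m • f + f') = m • conjHom g f + conjHom g f' := by
  refine (map_add (conjRep N A B g) _ _).trans ?_
  rw [map_smul]
  rfl

theorem exists_eq_sum_smul_conjHom_add (P : ProjectiveResolution (Rep.trivial k G k))
    (Q : ProjectiveResolution (Rep.trivial k N k)) (n : ℕ)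
    [Module.Finite (MonoidAlgebra k N)
      (Rep.equivalenceModuleMonoidAlgebra.functor.obj (Q.complex.X n))]
    (f₁ : (resSub N).obj (P.complex.X n) ⟶ Rep.leftRegular k N)
    (hf₁ : ∀ f : (resSub N).obj (P.complex.X n) ⟶ Rep.leftRegular k N,
      (resSub N).map (P.complex.d (n + 1) n) ≫ f = 0 →
        ∃ (m : k) (g : (resSub N).obj (P.complex.X (n - 1)) ⟶ Rep.leftRegular k N),
          f = m • f₁ + (resSub N).map (P.complex.d n (n - 1)) ≫ g)
    (F : (resSub N).obj (P.complex.X n) ⟶ (resSub N).obj (Rep.leftRegular k G))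
    (hF : (resSub N).map (P.complex.d (n + 1) n) ≫ F = 0) :
    ∃ (S : Finset (G ⧸ N)) (c : G ⧸ N → k)
      (E : (resSub N).obj (P.complex.X (n - 1)) ⟶ (resSub N).obj (Rep.leftRegular k G)),
      F = ∑ q ∈ S, c q • conjHom q.out (f₁ ≫ subInclusion N) +
        (resSub N).map (P.complex.d n (n - 1)) ≫ E := by
  obtain ⟨S, E, hE⟩ : ∃ (S : Finset (G ⧸ N))
      (E : (resSub N).obj (P.complex.X (n - 1)) ⟶ (resSub N).obj (Rep.leftRegular k G)),
      F = ∑ q ∈ S, F ≫ cosetProj N q + (resSub N).map (P.complex.d n (n - 1)) ≫ E :=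
    exists_eq_sum_cosetProj_add N ((resSub N).mapProjectiveResolution P) Q n F hF
  have h (q : G ⧸ N) : ∃ (m : k)
      (E : (resSub N).obj (P.complex.X (n - 1)) ⟶ (resSub N).obj (Rep.leftRegular k G)),
      F ≫ cosetProj N q = m • conjHom q.out (f₁ ≫ subInclusion N) +
        (resSub N).map (P.complex.d n (n - 1)) ≫ E := by
    obtain ⟨m, g, hg⟩ := hf₁ _ (map_comp_conjHom_comp_subProjection N hF q.out⁻¹)
    refine ⟨m, conjHom q.out (g ≫ subInclusion N), ?_⟩
    have := comp_cosetProj_mk N q.out F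
    rw [QuotientGroup.out_eq'] at this
    rw [this, hg, Preadditive.add_comp, Linear.smul_comp, conjHom_smul_add, map_comp_conjHom,
      Category.assoc]
  choose c E' hE' using h
  refine ⟨S, c, ∑ q ∈ S, E' q + E, hE.trans ?_⟩
  rw [Finset.sum_congr rfl fun q _ => hE' q, Finset.sum_add_distrib, Preadditive.comp_add,
    Preadditive.comp_sum, add_assoc]

theorem exactAt_homRepComplex (P : ProjectiveResolution (Rep.trivial k G k))
    (Q : ProjectiveResolution (Rep.trivial k N k)) (n : ℕ)
    [Module.Finite (MonoidAlgebra k N)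
      (Rep.equivalenceModuleMonoidAlgebra.functor.obj (Q.complex.X n))]
    (hn : Subsingleton (groupCohomology (Rep.leftRegular k N) n)) :
    (homRepComplex N P.complex (Rep.leftRegular k G)).ExactAt n := by
  rw [HomologicalComplex.exactAt_iff' _ (n - 1) n (n + 1) (prev_eq_sub_one n) (by simp),
    rep_exact_iff]
  intro (F : (resSub N).obj (P.complex.X n) ⟶ (resSub N).obj (Rep.leftRegular k G)) hF
  obtain ⟨S, c, E, hE⟩ := exists_eq_sum_smul_conjHom_add N P Q n 0 (fun f hf => by
    obtain ⟨g, hg⟩ := (subsingleton_groupCohomology_iff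
      ((resSub N).mapProjectiveResolution P) _ n).1 hn f hf
    refine ⟨0, g, ?_⟩
    rw [smul_zero, zero_add]
    exact hg.symm) F hF
  refine ⟨E, Eq.trans ?_ hE.symm⟩
  have (q : G ⧸ N) : conjHom q.out ((0 : (resSub N).obj (P.complex.X n) ⟶ Rep.leftRegular k N) ≫
      subInclusion N) = 0 := by
    rw [zero_comp]
    exact map_zero (conjRep N (P.complex.X n) (Rep.leftRegular k G) q.out)
  simp only [this, smul_zero, Finset.sum_const_zero, zero_add]
  rfl

end

section
variable {k G : Type} [CommRing k] [Group G] (N : Subgroup G) [N.Normal] {A : Rep.{0} k G}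

lemma homRep_ρ_eq_conjHom_out {B : Rep.{0} k G} (q : G ⧸ N)
    (f : (resSub N).obj A ⟶ (resSub N).obj B) :
    (homRep N A B).ρ q f = conjHom q.out f := by
  conv_lhs => rw [← QuotientGroup.out_eq' q]
  exact homRep_ρ_mk _ f

lemma conjHom_subInclusion_comp_cosetProj (q : G ⧸ N)
    (f : (resSub N).obj A ⟶ Rep.leftRegular k N) :
    conjHom q.out (f ≫ subInclusion N) ≫ cosetProj N q =
      conjHom q.out (f ≫ subInclusion N) := by
  have := conjHom_comp_cosetProj N q.out 1 (f ≫ subInclusion N)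
  rw [mul_one, QuotientGroup.out_eq', Category.assoc, subInclusion_cosetProj_one] at this
  exact this.symm

/-- The morphism from the regular representation of the quotient determined by a morphism to the
regular representation of the normal subgroup. -/
noncomputable def translates (f : (resSub N).obj A ⟶ Rep.leftRegular k N) :
    Rep.leftRegular k (G ⧸ N) ⟶ homRep N A (Rep.leftRegular k G) :=
  Rep.leftRegularHom _ (f ≫ subInclusion N : (resSub N).obj A ⟶ _)

lemma translates_single (f : (resSub N).obj A ⟶ Rep.leftRegular k N) (q : G ⧸ N) (c : k) :
    (translates N f).hom (MonoidAlgebra.single q c) = c • conjHom q.out (f ≫ subInclusion N) := by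
  refine (Rep.leftRegularHom_hom_single q _ c).trans ?_
  exact congrArg (c • ·) (homRep_ρ_eq_conjHom_out N q (f ≫ subInclusion N))

lemma translates_comp_cosetProj (f : (resSub N).obj A ⟶ Rep.leftRegular k N) (q : G ⧸ N)
    (v : MonoidAlgebra k (G ⧸ N)) :
    ((translates N f).hom v : (resSub N).obj A ⟶ (resSub N).obj _) ≫ cosetProj N q =
      v.coeff q • conjHom q.out (f ≫ subInclusion N) := by
  classical
  refine eq_of_basis (f := Linear.rightComp k ((resSub N).obj A) (cosetProj (k := k) N q) ∘ₗ
      (translates N f).hom.toLinearMap)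
    (g := LinearMap.toSpanSingleton k _ (conjHom q.out (f ≫ subInclusion N)) ∘ₗ
      Finsupp.lapply q ∘ₗ (MonoidAlgebra.coeffLinearEquiv k).toLinearMap) (fun q' => ?_) v
  change ((translates N f).hom _ : (resSub N).obj A ⟶ (resSub N).obj _) ≫ cosetProj N q =
    (MonoidAlgebra.single q' (1 : k)).coeff q • conjHom q.out (f ≫ subInclusion N)
  refine (congrArg (· ≫ cosetProj N q) ((translates_single N f q' 1).trans (one_smul k _))).trans ?_
  by_cases h : q' = q
  · subst h
    refine (conjHom_subInclusion_comp_cosetProj N q' f).trans ?_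
    simp
  · rw [← conjHom_subInclusion_comp_cosetProj, Category.assoc, cosetProj_comp_of_ne N h]
    simp [h]

end

section
variable {k G : Type} [CommRing k] [Group G] (N : Subgroup G) [N.Normal]

theorem nonempty_leftRegular_iso_homology (P : ProjectiveResolution (Rep.trivial k G k))
    (Q : ProjectiveResolution (Rep.trivial k N k)) (h : ℕ)
    [Module.Finite (MonoidAlgebra k N)
      (Rep.equivalenceModuleMonoidAlgebra.functor.obj (Q.complex.X h))]
    (e : groupCohomology (Rep.leftRegular k N) h ≃ₗ[k] k) :
    Nonempty (Rep.leftRegular k (G ⧸ N) ≅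
      (homRepComplex N P.complex (Rep.leftRegular k G)).homology h) := by
  obtain ⟨f₁, hd, hgen, hind⟩ : ∃ f₁ : (resSub N).obj (P.complex.X h) ⟶ Rep.leftRegular k N,
      (resSub N).map (P.complex.d (h + 1) h) ≫ f₁ = 0 ∧
      (∀ f : (resSub N).obj (P.complex.X h) ⟶ Rep.leftRegular k N,
        (resSub N).map (P.complex.d (h + 1) h) ≫ f = 0 →
          ∃ (m : k) (g : (resSub N).obj (P.complex.X (h - 1)) ⟶ Rep.leftRegular k N),
            f = m • f₁ + (resSub N).map (P.complex.d h (h - 1)) ≫ g) ∧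
      ∀ (m : k) (g : (resSub N).obj (P.complex.X (h - 1)) ⟶ Rep.leftRegular k N),
        m • f₁ = (resSub N).map (P.complex.d h (h - 1)) ≫ g → m = 0 :=
    exists_generator_of_groupCohomology_equiv ((resSub N).mapProjectiveResolution P) _ h e
  have hcocycle (q : G ⧸ N) : (resSub N).map (P.complex.d (h + 1) h) ≫
      conjHom q.out (f₁ ≫ subInclusion N) = 0 := by
    rw [map_comp_conjHom, ← Category.assoc, hd, zero_comp]
    exact map_zero (conjRep N (P.complex.X (h + 1)) (Rep.leftRegular k G) q.out)
  refine nonempty_iso_homology (homRepComplex N P.complex (Rep.leftRegular k G)) h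
    (translates N f₁) ?_ ?_ ?_
  · refine ofMulAction_hom_ext (X := G ⧸ N) fun q => ?_
    change (resSub N).map (P.complex.d (h + 1) h) ≫ ((translates N f₁).hom _ : (resSub N).obj _ ⟶
      (resSub N).obj _) = 0
    refine (congrArg _ ((translates_single N f₁ q 1).trans (one_smul k _))).trans ?_
    exact hcocycle q
  · intro (F : (resSub N).obj (P.complex.X h) ⟶ (resSub N).obj (Rep.leftRegular k G)) hF
    obtain ⟨S, c, E, hE⟩ := exists_eq_sum_smul_conjHom_add N P Q h f₁ hgen F hF
    refine ⟨∑ q ∈ S, MonoidAlgebra.single q (c q), E, hE.trans ?_⟩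
    refine congrArg (· + (resSub N).map (P.complex.d h (h - 1)) ≫ E) ?_
    refine Eq.trans ?_ (map_sum (translates N f₁).hom.toLinearMap _ S).symm
    exact Finset.sum_congr rfl fun q _ => (translates_single N f₁ q (c q)).symm
  · intro (v : MonoidAlgebra k (G ⧸ N))
      (E : (resSub N).obj (P.complex.X (h - 1)) ⟶ (resSub N).obj (Rep.leftRegular k G)) hE
    refine MonoidAlgebra.ext (Finsupp.ext fun q => ?_)
    refine hind _ (conjHom q.out⁻¹ (E ≫ cosetProj N q) ≫ subProjection N) ?_
    have h1 : v.coeff q • conjHom q.out (f₁ ≫ subInclusion N) =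
        (resSub N).map (P.complex.d h (h - 1)) ≫ E ≫ cosetProj N q :=
      (translates_comp_cosetProj N f₁ q v).symm.trans
        ((congrArg (· ≫ cosetProj N q) hE).trans (Category.assoc _ _ _))
    have h2 := congrArg (conjHom q.out⁻¹) h1
    rw [← map_comp_conjHom] at h2
    have h3 : conjHom q.out⁻¹ (v.coeff q • conjHom q.out (f₁ ≫ subInclusion N)) =
        v.coeff q • (f₁ ≫ subInclusion N) := by
      refine (map_smul (conjRep N _ _ q.out⁻¹) _ _).trans (congrArg (v.coeff q • ·) ?_)
      refine (conjHom_mul _ _ _).symm.trans ?_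
      rw [inv_mul_cancel, conjHom_one]
    have h4 := congrArg (· ≫ subProjection N) (h3.symm.trans h2)
    simp only [Linear.smul_comp, Category.assoc, subInclusion_subProjection,
      Category.comp_id] at h4
    exact h4

theorem subsingleton_groupCohomology_leftRegular_quotient_iff
    (Q : ProjectiveResolution (Rep.trivial k N k)) (h : ℕ)
    (hQ : ∀ i, Module.Finite (MonoidAlgebra k N)
      (Rep.equivalenceModuleMonoidAlgebra.functor.obj (Q.complex.X i)))
    (hzero : ∀ i, i ≠ h → Subsingleton (groupCohomology (Rep.leftRegular k N) i))
    (e : groupCohomology (Rep.leftRegular k N) h ≃ₗ[k] k) (p : ℕ) :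
    Subsingleton (groupCohomology (Rep.leftRegular k (G ⧸ N)) p) ↔
      Subsingleton (groupCohomology (Rep.leftRegular k G) (p + h)) := by
  let P := Rep.standardResolution k G
  obtain ⟨i⟩ := nonempty_leftRegular_iso_homology N P Q h e
  rw [← ModuleCat.isZero_iff_subsingleton]
  refine ((groupCohomology.functor k (G ⧸ N) p).mapIso i).isZero_iff.trans ?_
  refine (isZero_groupCohomology_homology_iff
    (homRepComplex N P.complex (Rep.leftRegular k G))
    (fun i => isAcyclicRep_homRep_standardComplex N i (Rep.leftRegular k G)) h
    (fun q hq => exactAt_homRepComplex N P Q q (hzero q hq)) p).trans ?_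
  exact subsingleton_groupCohomology_iff_invariants N P (Rep.leftRegular k G) (p + h)

end

end

/-- Let `1 → H → G → K → 1` be a short exact sequence of groups
(realized by a normal subgroup `H = N ≤ G` with `K = G/N`), where `H` is a Poincaré
duality group of cohomological dimension `h`.  Then for every `p ≥ 0`,
`H^p(K; ℤK) = 0 ↔ H^{p+h}(G; ℤG) = 0`.  In particular, if `K` is of type `FP` and `G` is
a duality group of cohomological dimension `h + k`, then `K` is a duality group of
cohomological dimension `k`. -/
theorem duality_group_quotient (G : Type) [Group G] (N : Subgroup G) [N.Normal]
    (h : ℕ) (hPD : IsPDGroup (↥N) h) :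
    (∀ p : ℕ, Subsingleton (cohZG (G ⧸ N) p) ↔ Subsingleton (cohZG G (p + h))) ∧
    (∀ k : ℕ, TypeFP (G ⧸ N) → IsDualityGroup G (h + k) → IsDualityGroup (G ⧸ N) k) := by
  obtain ⟨⟨Q, -, hQ, -⟩, hzero, ⟨e⟩⟩ := hPD
  have key (p : ℕ) : Subsingleton (cohZG (G ⧸ N) p) ↔ Subsingleton (cohZG G (p + h)) :=
    subsingleton_groupCohomology_leftRegular_quotient_iff N Q h hQ hzero e.intLinear p
  refine ⟨key, fun k hK hG => ⟨hK, fun i hi => ?_, ?_⟩⟩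
  · exact (key i).2 (hG.2.1 _ (by omega))
  · rw [← not_subsingleton_iff_nontrivial, key, add_comm, not_subsingleton_iff_nontrivial]
    exact hG.2.2
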